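/- Let G be a finitely generated group of exponential volume growth with a fixed finite symmetric generating set T (i.e., there exist c₁ > 0 and C₁ ≥ 1 with |B(e,n)| ≥ C₁⁻¹ e^{c₁ n} for all n), and let μ be a symmetric, non-degenerate probability measure on G. Assume the on-diagonal stretched-exponential upper bound: there exist β > 0 and c, C > 0 such that μ^(2m)(e) ≤ C exp(−c m^β) for all sufficiently large m. Then the walk is transient, and there exist a generator t ∈ T and δ₀ > 0 such that limsup_{n→∞} Δ(B(e,n); e, t) ≥ δ₀. In particular, along the exhausting sequence S_n = B(e,n), the quantities Δ(S_n; e, t) do not converge to 0. -/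

import Mathlib

open Filter Topology

noncomputable section

/- Convolution powers of a measure `μ` on a group: `convPow μ 0 = δ_e`,
`convPow μ (n+1) x = ∑_g convPow μ n g * μ (g⁻¹ x)`. -/
open Classical in
def convPow {G : Type*} [Group G] (μ : G → ℝ) : ℕ → G → ℝ
  | 0 => fun x => if x = 1 then 1 else 0
  | n + 1 => fun x => ∑' g : G, convPow μ n g * μ (g⁻¹ * x)

/-- The Green function `G(x,y) = ∑_{n≥0} μ^{(n)}(x⁻¹ y)`. -/
def green {G : Type*} [Group G] (μ : G → ℝ) (x y : G) : ℝ :=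
  ∑' n : ℕ, convPow μ n (x⁻¹ * y)

/-- `μ` is a probability measure on `G`. -/
def IsProbMeasure {G : Type*} (μ : G → ℝ) : Prop :=
  (∀ g, 0 ≤ μ g) ∧ HasSum μ 1

/-- `μ` is symmetric: `μ(g) = μ(g⁻¹)`. -/
def IsSymmetricMeasure {G : Type*} [Group G] (μ : G → ℝ) : Prop :=
  ∀ g : G, μ g = μ g⁻¹

/-- `μ` is non-degenerate: its support generates `G` as a semigroup. -/
def IsNonDegenerate {G : Type*} [Group G] (μ : G → ℝ) : Prop :=
  Subsemigroup.closure {g : G | μ g ≠ 0} = ⊤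

/-- Transience: the Green function is finite, i.e. the series converges. -/
def IsTransient {G : Type*} [Group G] (μ : G → ℝ) : Prop :=
  ∀ x y : G, Summable fun n : ℕ => convPow μ n (x⁻¹ * y)

/-- `f` is `μ`-harmonic: for every `k`, `∑_g μ(g) f(kg)` converges (absolutely,
since in `ℝ` summability is absolute) to `f k`. -/
def IsHarmonic {G : Type*} [Group G] (μ : G → ℝ) (f : G → ℝ) : Prop :=
  ∀ k : G, HasSum (fun g : G => μ g * f (k * g)) (f k)

/-- Word length of `x` with respect to a generating set `S`. -/
def wordLength {G : Type*} [Group G] (S : Set G) (x : G) : ℕ :=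
  sInf {n : ℕ | ∃ l : List G, l.length = n ∧ (∀ a ∈ l, a ∈ S) ∧ l.prod = x}

/-- Outer boundary of `F` with respect to the generating set `T`:
`∂F = {x ∉ F : ∃ y ∈ F, t ∈ T, x = y t}`. -/
def outerBoundary {G : Type*} [Group G] (T : Set G) (F : Set G) : Set G :=
  {x : G | x ∉ F ∧ ∃ y ∈ F, ∃ t ∈ T, x = y * t}

/-- The Green-variation functional
`Δ(F;a,b) = max_{x ∈ ∂F} |G(a,x) − G(b,x)| / G(a,x)`. -/
def greenDelta {G : Type*} [Group G] (μ : G → ℝ) (T : Set G) (F : Set G) (a b : G) : ℝ :=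
  sSup ((fun x => |green μ a x - green μ b x| / green μ a x) '' outerBoundary T F)

section ConvolutionPowers

variable {G : Type*} [Group G] {μ : G → ℝ}

theorem convPow_nonneg (hμ : ∀ g, 0 ≤ μ g) (n : ℕ) (x : G) : 0 ≤ convPow μ n x := by
  induction n generalizing x with
  | zero => simp only [convPow]; split_ifs <;> norm_num
  | succ n ih => exact tsum_nonneg fun g => mul_nonneg (ih g) (hμ _)

theorem IsProbMeasure.le_one {G : Type*} {μ : G → ℝ} (hμ : IsProbMeasure μ) (g : G) : μ g ≤ 1 :=
  le_hasSum hμ.2 g fun h _ => hμ.1 h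

theorem IsProbMeasure.hasSum_convPow (hμ : IsProbMeasure μ) (n : ℕ) :
    HasSum (convPow μ n) 1 := by
  classical
  induction n with
  | zero =>
    simp only [convPow]
    convert hasSum_ite_eq (1 : G) (1 : ℝ)
  | succ n ih =>
    have hprod : HasSum (fun p : G × G => convPow μ n p.1 * μ p.2) (1 * 1) :=
      ih.mul hμ.2 (ih.summable.mul_of_nonneg hμ.2.summable (convPow_nonneg hμ.1 n) hμ.1)
    let shear : G × G ≃ G × G :=
      { toFun := fun p => (p.2, p.2⁻¹ * p.1)
        invFun := fun p => (p.1 * p.2, p.1)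
        left_inv := fun p => by simp
        right_inv := fun p => by simp }
    have hshear := (shear.hasSum_iff (f := fun p : G × G => convPow μ n p.1 * μ p.2)).2 hprod
    rw [one_mul] at hshear
    exact hshear.prod_fiberwise fun x => (hshear.summable.prod_factor x).hasSum

theorem IsProbMeasure.convPow_le_one (hμ : IsProbMeasure μ) (n : ℕ) (x : G) :
    convPow μ n x ≤ 1 :=
  le_hasSum (hμ.hasSum_convPow n) x fun y _ => convPow_nonneg hμ.1 n y

theorem IsProbMeasure.summable_convPow_mul (hμ : IsProbMeasure μ) (m n : ℕ) (x : G) :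
    Summable fun g => convPow μ m g * convPow μ n (g⁻¹ * x) :=
  (hμ.hasSum_convPow m).summable.of_nonneg_of_le
    (fun g => mul_nonneg (convPow_nonneg hμ.1 m g) (convPow_nonneg hμ.1 n _))
    (fun g => mul_le_of_le_one_right (convPow_nonneg hμ.1 m g) (hμ.convPow_le_one n _))

theorem IsProbMeasure.summable_convPow_mul_self (hμ : IsProbMeasure μ) (n : ℕ) (x : G) :
    Summable fun g => convPow μ n g * μ (g⁻¹ * x) :=
  (hμ.hasSum_convPow n).summable.of_nonneg_of_le
    (fun g => mul_nonneg (convPow_nonneg hμ.1 n g) (hμ.1 _))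
    (fun g => mul_le_of_le_one_right (convPow_nonneg hμ.1 n g) (hμ.le_one _))

theorem IsProbMeasure.ofReal_convPow_succ (hμ : IsProbMeasure μ) (n : ℕ) (x : G) :
    ENNReal.ofReal (convPow μ (n + 1) x) =
      ∑' g, ENNReal.ofReal (convPow μ n g) * ENNReal.ofReal (μ (g⁻¹ * x)) := by
  rw [convPow, ENNReal.ofReal_tsum_of_nonneg
    (fun g => mul_nonneg (convPow_nonneg hμ.1 n g) (hμ.1 _)) (hμ.summable_convPow_mul_self n x)]
  exact tsum_congr fun g => ENNReal.ofReal_mul (convPow_nonneg hμ.1 n g)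

theorem IsProbMeasure.ofReal_convPow_add (hμ : IsProbMeasure μ) (m n : ℕ) (x : G) :
    ENNReal.ofReal (convPow μ (m + n) x) =
      ∑' g, ENNReal.ofReal (convPow μ m g) * ENNReal.ofReal (convPow μ n (g⁻¹ * x)) := by
  induction n generalizing x with
  | zero =>
    rw [tsum_eq_single x]
    · simp [convPow]
    · intro g hg
      have : g⁻¹ * x ≠ 1 := fun h => hg (inv_mul_eq_one.1 h)
      simp [convPow, this]
  | succ n ih =>
    rw [← add_assoc, hμ.ofReal_convPow_succ]
    simp_rw [ih, ← ENNReal.tsum_mul_right]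
    rw [ENNReal.tsum_comm]
    refine tsum_congr fun g => ?_
    rw [hμ.ofReal_convPow_succ, ← ENNReal.tsum_mul_left, ← (Equiv.mulLeft g).tsum_eq]
    refine tsum_congr fun h => ?_
    simp [mul_assoc]

/-- The Chapman–Kolmogorov equation for convolution powers. -/
theorem IsProbMeasure.convPow_add (hμ : IsProbMeasure μ) (m n : ℕ) (x : G) :
    convPow μ (m + n) x = ∑' g, convPow μ m g * convPow μ n (g⁻¹ * x) := by
  have hnn : ∀ g, 0 ≤ convPow μ m g * convPow μ n (g⁻¹ * x) := fun g =>
    mul_nonneg (convPow_nonneg hμ.1 m g) (convPow_nonneg hμ.1 n _)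
  rw [← ENNReal.ofReal_eq_ofReal_iff (convPow_nonneg hμ.1 _ x) (tsum_nonneg hnn),
    ENNReal.ofReal_tsum_of_nonneg hnn (hμ.summable_convPow_mul m n x), hμ.ofReal_convPow_add]
  exact tsum_congr fun g => (ENNReal.ofReal_mul (convPow_nonneg hμ.1 m g)).symm

theorem IsProbMeasure.convPow_mul_le (hμ : IsProbMeasure μ) (m n : ℕ) (g x : G) :
    convPow μ m g * convPow μ n (g⁻¹ * x) ≤ convPow μ (m + n) x := by
  rw [hμ.convPow_add]
  exact (hμ.summable_convPow_mul m n x).le_tsum g fun h _ =>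
    mul_nonneg (convPow_nonneg hμ.1 m h) (convPow_nonneg hμ.1 n _)

theorem convPow_one (x : G) : convPow μ 1 x = μ x := by
  simp only [convPow]
  rw [tsum_eq_single 1]
  · simp
  · intro g hg
    simp [hg]

theorem IsProbMeasure.convPow_inv (hμ : IsProbMeasure μ) (hsym : IsSymmetricMeasure μ)
    (n : ℕ) (x : G) : convPow μ n x⁻¹ = convPow μ n x := by
  induction n generalizing x with
  | zero => by_cases hx : x = 1 <;> simp [convPow, hx]
  | succ n ih =>
    rw [add_comm n 1, hμ.convPow_add 1 n x, add_comm 1 n]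
    refine ((Equiv.mulLeft x⁻¹).tsum_eq fun g => convPow μ n g * μ (g⁻¹ * x⁻¹)).symm.trans ?_
    refine tsum_congr fun g => ?_
    have h := ih (g⁻¹ * x)
    rw [mul_inv_rev, inv_inv] at h
    simp [convPow_one, h, ← hsym g, mul_comm (μ g)]

theorem IsProbMeasure.convPow_two_mul_le (hμ : IsProbMeasure μ) (hsym : IsSymmetricMeasure μ)
    (m : ℕ) (x : G) : convPow μ (2 * m) x ≤ convPow μ (2 * m) 1 := by
  have hsq : ∀ g, convPow μ m g * convPow μ m (g⁻¹ * 1) = convPow μ m g ^ 2 := fun g => by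
    rw [mul_one, hμ.convPow_inv hsym, sq]
  have hs : Summable fun g => convPow μ m g ^ 2 := by
    simpa only [hsq] using hμ.summable_convPow_mul m m 1
  have hone : convPow μ (2 * m) 1 = ∑' g, convPow μ m g ^ 2 := by
    rw [two_mul, hμ.convPow_add]
    exact tsum_congr hsq
  have htrans : ∀ g, convPow μ m (g⁻¹ * x) = convPow μ m ((Equiv.mulLeft x⁻¹) g) := fun g => by
    rw [← hμ.convPow_inv hsym]
    simp
  have hs' : Summable fun g => convPow μ m (g⁻¹ * x) ^ 2 := by
    simp_rw [htrans]
    exact ((Equiv.mulLeft x⁻¹).summable_iff (f := fun g => convPow μ m g ^ 2)).2 hs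
  have htsum : ∑' g, convPow μ m (g⁻¹ * x) ^ 2 = ∑' g, convPow μ m g ^ 2 := by
    simp_rw [htrans]
    exact (Equiv.mulLeft x⁻¹).tsum_eq fun g => convPow μ m g ^ 2
  have hle : 2 * convPow μ (2 * m) x ≤ ∑' g, (convPow μ m g ^ 2 + convPow μ m (g⁻¹ * x) ^ 2) := by
    rw [two_mul m, hμ.convPow_add, ← tsum_mul_left]
    refine ((hμ.summable_convPow_mul m m x).mul_left 2).tsum_le_tsum (fun g => ?_) (hs.add hs')
    nlinarith [sq_nonneg (convPow μ m g - convPow μ m (g⁻¹ * x))]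
  rw [hs.tsum_add hs', htsum] at hle
  linarith

theorem IsProbMeasure.convPow_le_diagonal (hμ : IsProbMeasure μ) (hsym : IsSymmetricMeasure μ)
    (n : ℕ) (x : G) : convPow μ n x ≤ convPow μ (2 * (n / 2)) 1 := by
  obtain ⟨m, rfl | rfl⟩ := Nat.even_or_odd' n
  · rw [Nat.mul_div_cancel_left m two_pos]
    exact hμ.convPow_two_mul_le hsym m x
  · rw [show (2 * m + 1) / 2 = m by omega, add_comm (2 * m) 1, hμ.convPow_add]
    simp_rw [convPow_one]
    have hle : ∀ g, μ g * convPow μ (2 * m) (g⁻¹ * x) ≤ μ g * convPow μ (2 * m) 1 := fun g =>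
      mul_le_mul_of_nonneg_left (hμ.convPow_two_mul_le hsym m _) (hμ.1 g)
    have hs := hμ.summable_convPow_mul 1 (2 * m) x
    simp_rw [convPow_one] at hs
    calc _ ≤ ∑' g, μ g * convPow μ (2 * m) 1 := hs.tsum_le_tsum hle (hμ.2.summable.mul_right _)
      _ = convPow μ (2 * m) 1 := by rw [tsum_mul_right, hμ.2.tsum_eq, one_mul]

theorem IsProbMeasure.exists_convPow_pos (hμ : IsProbMeasure μ) (hnd : IsNonDegenerate μ)
    (x : G) : ∃ n, 0 < convPow μ n x := by
  have hx : x ∈ Subsemigroup.closure {g : G | μ g ≠ 0} := by rw [hnd]; trivial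
  induction hx using Subsemigroup.closure_induction with
  | mem g hg => exact ⟨1, by rw [convPow_one]; exact lt_of_le_of_ne (hμ.1 g) (Ne.symm hg)⟩
  | mul g h _ _ hg hh =>
    obtain ⟨m, hm⟩ := hg
    obtain ⟨n, hn⟩ := hh
    refine ⟨m + n, lt_of_lt_of_le ?_ (hμ.convPow_mul_le m n g (g * h))⟩
    rw [inv_mul_cancel_left]
    exact mul_pos hm hn

end ConvolutionPowers

section WordLength

variable {G : Type*} [Group G] {S : Set G}

theorem wordLength_le_length {l : List G} (hl : ∀ a ∈ l, a ∈ S) :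
    wordLength S l.prod ≤ l.length :=
  Nat.sInf_le ⟨l, rfl, hl, rfl⟩

theorem exists_list_length_eq_wordLength (hsym : ∀ s ∈ S, s⁻¹ ∈ S)
    (hgen : Subgroup.closure S = ⊤) (x : G) :
    ∃ l : List G, l.length = wordLength S x ∧ (∀ a ∈ l, a ∈ S) ∧ l.prod = x := by
  refine Nat.sInf_mem (s := {n : ℕ | ∃ l : List G, l.length = n ∧ (∀ a ∈ l, a ∈ S) ∧ l.prod = x}) ?_
  have hinv : S⁻¹ ⊆ S := fun s hs => by simpa using hsym _ hs
  have hx : x ∈ Submonoid.closure S := by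
    rw [← Set.union_eq_left.2 hinv, ← Subgroup.closure_toSubmonoid, hgen]
    trivial
  obtain ⟨l, hl, hprod⟩ := Submonoid.exists_list_of_mem_closure hx
  exact ⟨l.length, l, rfl, hl, hprod⟩

theorem exists_inv_mul_wordLength_le (hsym : ∀ s ∈ S, s⁻¹ ∈ S)
    (hgen : Subgroup.closure S = ⊤) {x : G} {n : ℕ} (hx : wordLength S x = n + 1) :
    ∃ s ∈ S, wordLength S (s⁻¹ * x) ≤ n := by
  obtain ⟨l, hlen, hl, rfl⟩ := exists_list_length_eq_wordLength hsym hgen x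
  cases l with
  | nil => rw [hx] at hlen; simp at hlen
  | cons a l =>
    refine ⟨a, hl a (by simp), ?_⟩
    have h := wordLength_le_length (S := S) (l := l) fun b hb => hl b (by simp [hb])
    simp only [List.length_cons] at hlen
    simp only [List.prod_cons, inv_mul_cancel_left]
    omega

theorem mem_outerBoundary_of_wordLength_eq (hsym : ∀ s ∈ S, s⁻¹ ∈ S)
    (hgen : Subgroup.closure S = ⊤) {x : G} {n : ℕ} (hx : wordLength S x = n + 1) :
    x ∈ outerBoundary S {y : G | wordLength S y ≤ n} := by
  refine ⟨by simp [hx], ?_⟩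
  obtain ⟨l, hlen, hl, rfl⟩ := exists_list_length_eq_wordLength hsym hgen x
  obtain rfl | ⟨l, a, rfl⟩ := l.eq_nil_or_concat'
  · rw [hx] at hlen; simp at hlen
  · refine ⟨l.prod, ?_, a, hl a (by simp), by simp⟩
    have h := wordLength_le_length (S := S) (l := l) fun b hb => hl b (by simp [hb])
    simp only [List.length_append, List.length_singleton] at hlen
    change wordLength S l.prod ≤ n
    omega

end WordLength

section Green

variable {G : Type*} [Group G] {μ : G → ℝ}

/-- A sequence with stretched-exponential decay is summable against a linear weight. -/
theorem summable_mul_of_le_stretched_exp {q : ℕ → ℝ} (hq : ∀ m, 0 ≤ q m) {β c C : ℝ}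
    (hβ : 0 < β) (hc : 0 < c)
    (hle : ∀ᶠ m : ℕ in atTop, q m ≤ C * Real.exp (-(c * (m : ℝ) ^ β))) :
    Summable fun m : ℕ => ((m : ℝ) + 1) * q m := by
  have hpow : Tendsto (fun m : ℕ => (m : ℝ) ^ β) atTop atTop :=
    (tendsto_rpow_atTop hβ).comp tendsto_natCast_atTop_atTop
  have hexp : (fun m : ℕ => Real.exp (-(c * (m : ℝ) ^ β))) =O[atTop]
      fun m : ℕ => ((m : ℝ) ^ β) ^ (-3 / β) := by
    simpa only [Function.comp_def, neg_mul] using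
      ((isLittleO_exp_neg_mul_rpow_atTop hc (-3 / β)).comp_tendsto hpow).isBigO
  have hqO : q =O[atTop] fun m : ℕ => ((m : ℝ) ^ β) ^ (-3 / β) := by
    refine Asymptotics.IsBigO.trans (Asymptotics.IsBigO.of_bound C ?_) hexp
    filter_upwards [hle] with m hm
    rwa [Real.norm_of_nonneg (hq m), Real.norm_of_nonneg (Real.exp_pos _).le]
  have hlin : (fun m : ℕ => (m : ℝ) + 1) =O[atTop] fun m : ℕ => (m : ℝ) := by
    refine Asymptotics.IsBigO.of_bound 2 ?_
    filter_upwards [eventually_ge_atTop 1] with m hm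
    have : (1 : ℝ) ≤ m := by exact_mod_cast hm
    rw [Real.norm_of_nonneg (by positivity), Real.norm_of_nonneg (by positivity)]
    linarith
  refine summable_of_isBigO_nat (Real.summable_nat_rpow.2 (by norm_num : (-2 : ℝ) < -1))
    ((hlin.mul hqO).congr' EventuallyEq.rfl ?_)
  filter_upwards [eventually_ge_atTop 1] with m hm
  have hm0 : (0 : ℝ) < m := by exact_mod_cast hm
  rw [← Real.rpow_mul hm0.le, mul_div_cancel₀ _ hβ.ne']
  nth_rewrite 1 [← Real.rpow_one (m : ℝ)]
  rw [← Real.rpow_add hm0]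
  norm_num

theorem IsProbMeasure.exists_summable_majorant (hμ : IsProbMeasure μ)
    (hsym : IsSymmetricMeasure μ) {β c C : ℝ} (hβ : 0 < β) (hc : 0 < c)
    (hle : ∀ᶠ m : ℕ in atTop, convPow μ (2 * m) 1 ≤ C * Real.exp (-(c * (m : ℝ) ^ β))) :
    ∃ s : ℕ → ℝ, (∀ n x, convPow μ n x ≤ s n) ∧ Summable fun n : ℕ => ((n : ℝ) + 1) * s n := by
  refine ⟨fun n => convPow μ (2 * (n / 2)) 1, hμ.convPow_le_diagonal hsym, ?_⟩
  have hq := summable_mul_of_le_stretched_exp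
    (fun m => convPow_nonneg hμ.1 (2 * m) (1 : G)) hβ hc hle
  have hnn := fun m => convPow_nonneg hμ.1 (2 * m) (1 : G)
  apply Summable.even_add_odd
  · refine (hq.mul_left 2).of_nonneg_of_le (fun m => ?_) fun m => ?_
    · exact mul_nonneg (by positivity) (hnn _)
    · beta_reduce
      rw [Nat.mul_div_cancel_left m two_pos, ← mul_assoc]
      refine mul_le_mul_of_nonneg_right ?_ (hnn m)
      push_cast
      linarith
  · refine (hq.mul_left 2).of_nonneg_of_le (fun m => ?_) fun m => ?_
    · exact mul_nonneg (by positivity) (hnn _)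
    · beta_reduce
      rw [show (2 * m + 1) / 2 = m by omega, ← mul_assoc]
      refine mul_le_mul_of_nonneg_right ?_ (hnn m)
      push_cast
      linarith

theorem IsProbMeasure.isTransient_of_majorant (hμ : IsProbMeasure μ) {s : ℕ → ℝ}
    (hs : ∀ n x, convPow μ n x ≤ s n) (hsum : Summable fun n : ℕ => ((n : ℝ) + 1) * s n) :
    IsTransient μ := by
  intro x y
  refine hsum.of_nonneg_of_le (fun n => convPow_nonneg hμ.1 n _) fun n => ?_
  have h := hs n (x⁻¹ * y)
  have h0 := convPow_nonneg hμ.1 n (x⁻¹ * y)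
  nlinarith [(Nat.cast_nonneg n : (0 : ℝ) ≤ n)]

theorem green_eq_green_one (x y : G) : green μ x y = green μ 1 (x⁻¹ * y) := by
  simp [green]

theorem IsTransient.summable (htr : IsTransient μ) (x : G) :
    Summable fun n : ℕ => convPow μ n x := by
  simpa using htr 1 x

theorem IsProbMeasure.convPow_mul_green_le (hμ : IsProbMeasure μ) (htr : IsTransient μ)
    (k : ℕ) (t x : G) : convPow μ k t * green μ t x ≤ green μ 1 x := by
  have hx := htr.summable x
  simp only [green, inv_one, one_mul]
  rw [← tsum_mul_left]
  calc _ ≤ ∑' n, convPow μ (n + k) x := by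
        refine ((htr t x).mul_left _).tsum_le_tsum (fun n => ?_) ((summable_nat_add_iff k).2 hx)
        rw [add_comm n k]
        exact hμ.convPow_mul_le k n t x
    _ ≤ _ := by
        rw [← hx.sum_add_tsum_nat_add k]
        exact le_add_of_nonneg_left (Finset.sum_nonneg fun n _ => convPow_nonneg hμ.1 n x)

theorem IsProbMeasure.green_nonneg (hμ : IsProbMeasure μ) (x y : G) : 0 ≤ green μ x y :=
  tsum_nonneg fun n => convPow_nonneg hμ.1 n _

theorem IsProbMeasure.green_pos (hμ : IsProbMeasure μ) (hnd : IsNonDegenerate μ)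
    (htr : IsTransient μ) (x y : G) : 0 < green μ x y := by
  obtain ⟨k, hk⟩ := hμ.exists_convPow_pos hnd (x⁻¹ * y)
  exact (htr x y).tsum_pos (fun n => convPow_nonneg hμ.1 n _) k hk

theorem IsProbMeasure.exists_green_variation_le (hμ : IsProbMeasure μ) (hnd : IsNonDegenerate μ)
    (htr : IsTransient μ) (t : G) :
    ∃ M, 0 ≤ M ∧ ∀ x, |green μ 1 x - green μ t x| / green μ 1 x ≤ M := by
  obtain ⟨k, hk⟩ := hμ.exists_convPow_pos hnd t
  refine ⟨1 + (convPow μ k t)⁻¹, by positivity, fun x => ?_⟩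
  have hpos := hμ.green_pos hnd htr 1 x
  rw [div_le_iff₀ hpos]
  have h : green μ t x ≤ (convPow μ k t)⁻¹ * green μ 1 x :=
    (le_inv_mul_iff₀ hk).2 (hμ.convPow_mul_green_le htr k t x)
  have ht := hμ.green_nonneg t x
  rw [abs_le]
  constructor <;> nlinarith [mul_pos (inv_pos.2 hk) hpos]

theorem greenDelta_nonneg (hμ : IsProbMeasure μ) (T F : Set G) (a b : G) :
    0 ≤ greenDelta μ T F a b := by
  refine Real.sSup_nonneg ?_
  rintro _ ⟨x, -, rfl⟩
  exact div_nonneg (abs_nonneg _) (hμ.green_nonneg a x)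

theorem le_greenDelta {T F : Set G} {a b : G} {M : ℝ}
    (hM : ∀ x, |green μ a x - green μ b x| / green μ a x ≤ M) {x : G}
    (hx : x ∈ outerBoundary T F) :
    |green μ a x - green μ b x| / green μ a x ≤ greenDelta μ T F a b := by
  refine le_csSup ⟨M, ?_⟩ ⟨x, hx, rfl⟩
  rintro _ ⟨y, -, rfl⟩
  exact hM y

theorem greenDelta_le {T F : Set G} {a b : G} {M : ℝ} (hM0 : 0 ≤ M)
    (hM : ∀ x, |green μ a x - green μ b x| / green μ a x ≤ M) :
    greenDelta μ T F a b ≤ M := by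
  refine Real.sSup_le ?_ hM0
  rintro _ ⟨y, -, rfl⟩
  exact hM y

/-- The expected time spent in a finite set, split at time `K`. -/
theorem IsProbMeasure.sum_green_le (hμ : IsProbMeasure μ) {s : ℕ → ℝ}
    (hs : ∀ n x, convPow μ n x ≤ s n) (hsum : Summable fun n : ℕ => ((n : ℝ) + 1) * s n)
    (F : Finset G) {K : ℕ} (hK : 0 < K) :
    ∑ x ∈ F, green μ 1 x ≤ K + F.card * ((∑' n : ℕ, ((n : ℝ) + 1) * s n) / K) := by
  have htr := hμ.isTransient_of_majorant hs hsum
  have hs0 : ∀ n, 0 ≤ s n := fun n => (convPow_nonneg hμ.1 n 1).trans (hs n 1)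
  have hK' : (0 : ℝ) < K := by exact_mod_cast hK
  have hpoint : ∀ x, green μ 1 x ≤
      ∑ n ∈ Finset.range K, convPow μ n x + (∑' n : ℕ, ((n : ℝ) + 1) * s n) / K := by
    intro x
    have hx := htr.summable x
    simp only [green, inv_one, one_mul]
    rw [← hx.sum_add_tsum_nat_add K]
    gcongr
    rw [← tsum_div_const, ← (hsum.div_const (K : ℝ)).sum_add_tsum_nat_add K]
    refine le_add_of_nonneg_of_le
      (Finset.sum_nonneg fun n _ => div_nonneg (mul_nonneg (by positivity) (hs0 n)) hK'.le) ?_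
    refine ((summable_nat_add_iff K).2 hx).tsum_le_tsum (fun n => ?_)
      ((summable_nat_add_iff K).2 (hsum.div_const (K : ℝ)))
    refine (hs (n + K) x).trans ?_
    rw [le_div_iff₀ hK', mul_comm]
    refine mul_le_mul_of_nonneg_right ?_ (hs0 _)
    push_cast
    linarith [(Nat.cast_nonneg n : (0 : ℝ) ≤ n)]
  calc ∑ x ∈ F, green μ 1 x
      ≤ ∑ x ∈ F, (∑ n ∈ Finset.range K, convPow μ n x +
          (∑' n : ℕ, ((n : ℝ) + 1) * s n) / K) := Finset.sum_le_sum fun x _ => hpoint x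
    _ = ∑ n ∈ Finset.range K, ∑ x ∈ F, convPow μ n x +
          F.card * ((∑' n : ℕ, ((n : ℝ) + 1) * s n) / K) := by
        rw [Finset.sum_add_distrib, Finset.sum_comm, Finset.sum_const, nsmul_eq_mul]
    _ ≤ _ := by
        gcongr
        calc _ ≤ ∑ _n ∈ Finset.range K, (1 : ℝ) := Finset.sum_le_sum fun n _ =>
              sum_le_hasSum F (fun x _ => convPow_nonneg hμ.1 n x) (hμ.hasSum_convPow n)
          _ = K := by simp

end Green

section SubexponentialDecay

variable {G : Type*} [Group G] {μ : G → ℝ}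

theorem tendsto_zero_of_not_limsup_pos {u : ℕ → ℝ} {M : ℝ} (hu : ∀ n, 0 ≤ u n)
    (hM : ∀ n, u n ≤ M) (h : ¬ 0 < limsup u atTop) : Tendsto u atTop (𝓝 0) := by
  have hle : IsBoundedUnder (· ≤ ·) atTop u := isBoundedUnder_of ⟨M, hM⟩
  have hge : IsBoundedUnder (· ≥ ·) atTop u := isBoundedUnder_of ⟨0, hu⟩
  exact tendsto_of_le_liminf_of_limsup_le
    (le_liminf_of_le hle.isCoboundedUnder_ge (Eventually.of_forall hu)) (not_lt.1 h) hle hge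

/-- If the Green variation over balls tends to zero for every generator, then the Green function
decays slower than any prescribed exponential. -/
theorem IsProbMeasure.exists_le_pow_mul_green (hμ : IsProbMeasure μ) (hnd : IsNonDegenerate μ)
    (htr : IsTransient μ) {T : Finset G} (hTsym : ∀ t ∈ T, t⁻¹ ∈ T)
    (hTgen : Subgroup.closure (T : Set G) = ⊤)
    (hfin : ∀ n : ℕ, {x : G | wordLength (T : Set G) x ≤ n}.Finite)
    (hΔ : ∀ t ∈ T, Tendsto
      (fun n : ℕ => greenDelta μ (T : Set G) {x : G | wordLength (T : Set G) x ≤ n} 1 t)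
      atTop (𝓝 0)) {r : ℝ} (hr : 1 < r) :
    ∃ a > 0, ∃ n₀ : ℕ, ∀ n : ℕ, ∀ x : G, wordLength (T : Set G) x ≤ n₀ + n →
      a ≤ r ^ n * green μ 1 x := by
  have hev : ∀ᶠ n : ℕ in atTop, ∀ t ∈ T,
      greenDelta μ (T : Set G) {x : G | wordLength (T : Set G) x ≤ n} 1 t < r - 1 :=
    (Finset.eventually_all T).2 fun t ht => (hΔ t ht).eventually_lt_const (sub_pos.2 hr)
  obtain ⟨n₀, hn₀⟩ := eventually_atTop.1 hev
  have hmin : ∃ a > 0, ∀ x : G, wordLength (T : Set G) x ≤ n₀ → a ≤ green μ 1 x := by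
    obtain hempty | hne := {x : G | wordLength (T : Set G) x ≤ n₀}.eq_empty_or_nonempty
    · exact ⟨1, one_pos, fun x hx => (Set.eq_empty_iff_forall_notMem.1 hempty x hx).elim⟩
    · obtain ⟨y, -, hy⟩ := Set.exists_min_image _ (green μ 1) (hfin n₀) hne
      exact ⟨green μ 1 y, hμ.green_pos hnd htr 1 y, hy⟩
  obtain ⟨a, ha, hmin⟩ := hmin
  refine ⟨a, ha, n₀, fun n => ?_⟩
  induction n with
  | zero => simpa using hmin
  | succ n ih =>
    intro x hx
    have hpos := hμ.green_pos hnd htr 1 x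
    obtain hlt | heq := hx.lt_or_eq
    · refine (ih x (by omega)).trans ?_
      gcongr
      · exact hr.le
      · exact n.le_succ
    · obtain ⟨t, ht, hlen⟩ := exists_inv_mul_wordLength_le (S := (T : Set G)) hTsym hTgen heq
      obtain ⟨M, -, hM⟩ := hμ.exists_green_variation_le hnd htr t
      have hvar := (le_greenDelta hM (mem_outerBoundary_of_wordLength_eq (S := (T : Set G))
        hTsym hTgen heq)).trans (hn₀ (n₀ + n) (by omega) t ht).le
      rw [div_le_iff₀ hpos] at hvar
      have hstep : green μ t x ≤ r * green μ 1 x := by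
        linarith [neg_abs_le (green μ 1 x - green μ t x)]
      have hprev := ih _ hlen
      rw [← green_eq_green_one] at hprev
      calc a ≤ r ^ n * green μ t x := hprev
        _ ≤ r ^ n * (r * green μ 1 x) := by gcongr
        _ = r ^ (n + 1) * green μ 1 x := by ring

/-- On a group of exponential growth the Green variation over balls cannot vanish asymptotically
for all generators at once. -/
theorem IsProbMeasure.not_forall_tendsto_greenDelta (hμ : IsProbMeasure μ)
    (hnd : IsNonDegenerate μ) {s : ℕ → ℝ} (hs : ∀ n x, convPow μ n x ≤ s n)
    (hsum : Summable fun n : ℕ => ((n : ℝ) + 1) * s n)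
    {T : Finset G} (hTsym : ∀ t ∈ T, t⁻¹ ∈ T) (hTgen : Subgroup.closure (T : Set G) = ⊤)
    {c C : ℝ} (hc : 0 < c) (hC : 0 < C)
    (hgrowth : ∀ n : ℕ,
      C⁻¹ * Real.exp (c * n) ≤ (Nat.card {x : G // wordLength (T : Set G) x ≤ n} : ℝ)) :
    ¬ ∀ t ∈ T, Tendsto
      (fun n : ℕ => greenDelta μ (T : Set G) {x : G | wordLength (T : Set G) x ≤ n} 1 t)
      atTop (𝓝 0) := by
  intro hΔ
  have htr := hμ.isTransient_of_majorant hs hsum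
  have hcard : ∀ n : ℕ, 0 < Nat.card {x : G // wordLength (T : Set G) x ≤ n} := fun n => by
    have h := (by positivity : (0 : ℝ) < C⁻¹ * Real.exp (c * n)).trans_le (hgrowth n)
    exact_mod_cast h
  have hfin : ∀ n : ℕ, {x : G | wordLength (T : Set G) x ≤ n}.Finite := fun n =>
    @Set.toFinite _ _ (Nat.finite_of_card_ne_zero (hcard n).ne')
  obtain ⟨a, ha, n₀, hlow⟩ := hμ.exists_le_pow_mul_green hnd htr hTsym hTgen hfin hΔ
    (Real.one_lt_exp_iff.2 (by positivity : 0 < c / 4))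
  set M := ∑' n : ℕ, ((n : ℝ) + 1) * s n with hMdef
  have hM : 0 ≤ M := tsum_nonneg fun n =>
    mul_nonneg (by positivity) ((convPow_nonneg hμ.1 n 1).trans (hs n 1))
  have hbound : ∀ n : ℕ, a * Real.exp (c / 4 * n) ≤ 2 * C + M := by
    intro n
    set E := Real.exp (c / 4 * n) with hE
    have hE1 : 1 ≤ E := Real.one_le_exp (by positivity)
    have hE0 : 0 < E := Real.exp_pos _
    set F := (hfin (n₀ + n)).toFinset with hF
    have hFcard : C⁻¹ * E ^ 4 ≤ F.card := by
      have h1 := hgrowth (n₀ + n)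
      have h2 : Nat.card {x : G // wordLength (T : Set G) x ≤ n₀ + n} = F.card :=
        Nat.card_eq_card_finite_toFinset (hfin (n₀ + n))
      rw [h2] at h1
      refine le_trans ?_ h1
      rw [hE, ← Real.exp_nat_mul]
      refine mul_le_mul_of_nonneg_left (Real.exp_le_exp.2 ?_) (by positivity)
      push_cast
      nlinarith [(Nat.cast_nonneg n₀ : (0 : ℝ) ≤ n₀)]
    have hF0 : (0 : ℝ) < F.card := lt_of_lt_of_le (by positivity) hFcard
    have hK1 : E ^ 2 ≤ (⌈E ^ 2⌉₊ : ℝ) := Nat.le_ceil _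
    have hK2 : (⌈E ^ 2⌉₊ : ℝ) ≤ 2 * E ^ 2 := by
      have := (Nat.ceil_lt_add_one (by positivity : 0 ≤ E ^ 2)).le
      nlinarith
    have hK0 : 0 < ⌈E ^ 2⌉₊ := Nat.ceil_pos.2 (by positivity)
    have hup := hμ.sum_green_le hs hsum F hK0
    rw [← hMdef] at hup
    have hlowF : F.card * (a / E) ≤ ∑ x ∈ F, green μ 1 x := by
      rw [← nsmul_eq_mul]
      refine Finset.card_nsmul_le_sum _ _ _ fun x hx => ?_
      have h := hlow n x (by simpa [hF] using hx)
      rw [← Real.exp_nat_mul, mul_comm (n : ℝ), ← hE] at h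
      rw [div_le_iff₀ hE0, mul_comm]
      exact h
    have hfirst : 2 * E ^ 2 ≤ F.card * (2 * C / E ^ 2) := by
      have h : C⁻¹ * E ^ 4 * (2 * C / E ^ 2) = 2 * E ^ 2 := by field_simp
      rw [← h]
      gcongr
    have hsecond : F.card * (M / (⌈E ^ 2⌉₊ : ℝ)) ≤ F.card * (M / E ^ 2) := by gcongr
    have htotal : F.card * (a / E) ≤ F.card * ((2 * C + M) / E ^ 2) := by
      rw [add_div, mul_add]
      linarith
    have hdiv := le_of_mul_le_mul_left htotal hF0
    rw [div_le_div_iff₀ hE0 (by positivity)] at hdiv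
    refine le_of_mul_le_mul_right ?_ hE0
    linarith
  have htop : Tendsto (fun n : ℕ => a * Real.exp (c / 4 * n)) atTop atTop :=
    (Real.tendsto_exp_atTop.comp
      (tendsto_natCast_atTop_atTop.const_mul_atTop (by positivity))).const_mul_atTop ha
  obtain ⟨n, hn⟩ := (htop.eventually_gt_atTop (2 * C + M)).exists
  exact absurd (hbound n) (not_le.2 hn)

end SubexponentialDecay

/-- On a group of exponential growth, under a stretched-exponential
on-diagonal upper bound, the walk is transient and `Δ(B(e,n);e,t)` does not tend to
`0`: its limsup is at least some `δ₀ > 0` for some generator `t`. -/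
theorem exponential_growth_obstruction_to_delta_decay
    {G : Type*} [Group G] (μ : G → ℝ)
    (T : Finset G) (hTsym : ∀ t ∈ T, t⁻¹ ∈ T)
    (hTgen : Subgroup.closure (T : Set G) = ⊤)
    -- exponential volume growth
    (hgrowth : ∃ c₁ > (0:ℝ), ∃ C₁ ≥ (1:ℝ), ∀ n : ℕ,
      C₁⁻¹ * Real.exp (c₁ * n) ≤ (Nat.card {x : G // wordLength (T : Set G) x ≤ n} : ℝ))
    (hprob : IsProbMeasure μ) (hsym : IsSymmetricMeasure μ) (hnd : IsNonDegenerate μ)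
    -- stretched-exponential on-diagonal upper bound (HK_β)
    (hHK : ∃ β > (0:ℝ), ∃ c > (0:ℝ), ∃ C > (0:ℝ), ∀ᶠ m : ℕ in atTop,
      convPow μ (2 * m) 1 ≤ C * Real.exp (-(c * (m : ℝ) ^ β))) :
    IsTransient μ ∧
    ∃ t ∈ T, ∃ δ₀ > (0:ℝ),
      δ₀ ≤ Filter.limsup
        (fun n : ℕ => greenDelta μ (T : Set G) {x : G | wordLength (T : Set G) x ≤ n} 1 t)
        atTop ∧
      ¬ Tendsto
        (fun n : ℕ => greenDelta μ (T : Set G) {x : G | wordLength (T : Set G) x ≤ n} 1 t)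
        atTop (nhds 0) := by
  obtain ⟨c₁, hc₁, C₁, hC₁, hgrowth⟩ := hgrowth
  obtain ⟨β, hβ, c, hc, C, -, hle⟩ := hHK
  obtain ⟨s, hs, hsum⟩ := hprob.exists_summable_majorant hsym hβ hc hle
  have htr := hprob.isTransient_of_majorant hs hsum
  refine ⟨htr, ?_⟩
  by_contra hno
  refine hprob.not_forall_tendsto_greenDelta hnd hs hsum hTsym hTgen hc₁
    (zero_lt_one.trans_le hC₁) hgrowth fun t ht => ?_
  by_contra hnt
  obtain ⟨M, hM0, hM⟩ := hprob.exists_green_variation_le hnd htr t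
  refine hno ⟨t, ht, _, ?_, le_rfl, hnt⟩
  by_contra hpos
  exact hnt (tendsto_zero_of_not_limsup_pos (fun n => greenDelta_nonneg hprob _ _ _ _)
    (fun n => greenDelta_le hM0 hM) hpos)
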